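/- Let d be a real number with 0 < d < 1/2. Then the iterated integral ∫₀¹∫₀^{y₁}∫₀^{y₂}∫₀^{y₃}∫₀^{y₄} (y₁−y₃)^(−d)(y₃−y₄)^(−d)(y₂−y₄)^(−d)(y₂−y₅)^(−d)(y₁−y₅)^(−d) dy₅ dy₄ dy₃ dy₂ dy₁ equals (Γ(1−d)/(1−d))·(Γ(2d−1)/Γ(2d))·(Γ(3−3d)·Γ(4−5d)/(Γ(6−5d)·Γ(4−4d)))·₃F₂(1, d, 2d−1; 2−d, 2d; 1) − Γ(1−d)³·(Γ(4−5d)/(Γ(4−4d)·Γ(6−5d)))·(Γ(2−2d)·Γ(2d−1)/Γ(d)) + (Γ(1−d)²/(3(1−d)²))·(Γ(4−5d)/(Γ(6−5d)·Γ(2−2d)))·₃F₂(1, d, 3−3d; 2−d, 4−3d; 1). -/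

import Mathlib

open Real

noncomputable def poch (a : ℝ) (k : ℕ) : ℝ := ∏ i ∈ Finset.range k, (a + i)

noncomputable def F21 (a b c x : ℝ) : ℝ :=
  ∑' k : ℕ, poch a k * poch b k / (poch c k * (Nat.factorial k : ℝ)) * x ^ k

noncomputable def F32 (a b c e f : ℝ) : ℝ :=
  ∑' k : ℕ, poch a k * poch b k * poch c k / (poch e k * poch f k * (Nat.factorial k : ℝ))

noncomputable def F32x (a b c e f x : ℝ) : ℝ :=
  ∑' k : ℕ, poch a k * poch b k * poch c k / (poch e k * poch f k * (Nat.factorial k : ℝ)) * x ^ k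

noncomputable def F43 (a b c g e f h : ℝ) : ℝ :=
  ∑' k : ℕ, poch a k * poch b k * poch c k * poch g k /
    (poch e k * poch f k * poch h k * (Nat.factorial k : ℝ))

open MeasureTheory Set

lemma measM {α : Type*} [MeasurableSpace α] {u v : α → ℝ} {F : α → ℝ → ENNReal}
    (hu : Measurable u) (hv : Measurable v) (hF : Measurable (Function.uncurry F)) :
    Measurable fun x => ∫⁻ y in Ioo (u x) (v x), F x y := by
  have h : (fun x => ∫⁻ y in Ioo (u x) (v x), F x y) =
      fun x => ∫⁻ y, ({p : α × ℝ | u p.1 < p.2 ∧ p.2 < v p.1}.indicator (Function.uncurry F)) (x, y) := by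
    funext x
    rw [← lintegral_indicator measurableSet_Ioo]
    rfl
  rw [h]
  apply Measurable.lintegral_prod_right'
  apply hF.indicator
  apply MeasurableSet.inter
  · exact measurableSet_lt (hu.comp measurable_fst) measurable_snd
  · exact measurableSet_lt measurable_snd (hv.comp measurable_fst)

lemma triSwap {F : ℝ → ℝ → ENNReal} (hF : Measurable (Function.uncurry F)) (a b : ℝ) :
    ∫⁻ x in Ioo a b, ∫⁻ y in Ioo a x, F x y = ∫⁻ y in Ioo a b, ∫⁻ x in Ioo y b, F x y := by
  have hS : MeasurableSet {p : ℝ × ℝ | a < p.2 ∧ p.2 < p.1 ∧ p.1 < b} := by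
    apply MeasurableSet.inter (measurableSet_lt measurable_const measurable_snd)
    exact MeasurableSet.inter (measurableSet_lt measurable_snd measurable_fst)
      (measurableSet_lt measurable_fst measurable_const)
  set G : ℝ → ℝ → ENNReal := fun x y =>
    {p : ℝ × ℝ | a < p.2 ∧ p.2 < p.1 ∧ p.1 < b}.indicator (Function.uncurry F) (x, y) with hG
  have hGm : Measurable (Function.uncurry G) := hF.indicator hS
  have h1 : ∫⁻ x in Ioo a b, ∫⁻ y in Ioo a x, F x y = ∫⁻ x, ∫⁻ y, G x y := by
    rw [← lintegral_indicator measurableSet_Ioo]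
    refine lintegral_congr fun x => ?_
    by_cases hx : x ∈ Ioo a b
    · rw [indicator_of_mem hx, ← lintegral_indicator measurableSet_Ioo]
      refine lintegral_congr fun y => ?_
      simp only [hG, indicator, mem_Ioo, mem_ofPred_eq, Function.uncurry]
      congr 1
      exact propext ⟨fun h => ⟨h.1, h.2, hx.2⟩, fun h => ⟨h.1, h.2.1⟩⟩
    · rw [indicator_of_notMem hx]
      symm
      rw [lintegral_eq_zero_iff' (by fun_prop)]
      filter_upwards with y
      simp only [hG]
      apply indicator_of_notMem
      rintro ⟨h1, h2, h3⟩
      exact hx ⟨h1.trans h2, h3⟩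
  have h2 : ∫⁻ y in Ioo a b, ∫⁻ x in Ioo y b, F x y = ∫⁻ y, ∫⁻ x, G x y := by
    rw [← lintegral_indicator measurableSet_Ioo]
    refine lintegral_congr fun y => ?_
    by_cases hx : y ∈ Ioo a b
    · rw [indicator_of_mem hx, ← lintegral_indicator measurableSet_Ioo]
      refine lintegral_congr fun x => ?_
      simp only [hG, indicator, mem_Ioo, mem_ofPred_eq, Function.uncurry]
      congr 1
      exact propext ⟨fun h => ⟨hx.1, h⟩, fun h => h.2⟩
    · rw [indicator_of_notMem hx]
      symm
      rw [lintegral_eq_zero_iff' (by fun_prop)]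
      filter_upwards with x
      simp only [hG]
      apply indicator_of_notMem
      rintro ⟨h1, h2, h3⟩
      exact hx ⟨h1, h2.trans h3⟩
  rw [h1, h2, lintegral_lintegral_swap hGm.aemeasurable]

lemma affSub (f : ℝ → ENNReal) (p : ℝ) {q : ℝ} (hq : 0 < q) (a b : ℝ) :
    ∫⁻ x in Ioo (p + q * a) (p + q * b), f x =
      ENNReal.ofReal q * ∫⁻ t in Ioo a b, f (p + q * t) := by
  have him : (fun t => p + q * t) '' Ioo a b = Ioo (p + q * a) (p + q * b) := by
    ext y
    simp only [mem_image, mem_Ioo]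
    constructor
    · rintro ⟨t, ⟨h1, h2⟩, rfl⟩
      constructor <;> nlinarith
    · rintro ⟨h1, h2⟩
      refine ⟨(y - p) / q, ⟨?_, ?_⟩, by field_simp; ring⟩
      · rw [lt_div_iff₀ hq]; linarith
      · rw [div_lt_iff₀ hq]; linarith
  rw [← him, lintegral_image_eq_lintegral_abs_deriv_mul (f' := fun _ => q) measurableSet_Ioo]
  · rw [lintegral_const_mul' _ _ (by simp), abs_of_pos hq]
  · intro x _
    simpa using (((hasDerivAt_id x).const_mul q).const_add p).hasDerivWithinAt
  · intro x _ y _ h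
    have : q * x = q * y := by simpa using h
    exact mul_left_cancel₀ hq.ne' this

lemma reflSub (f : ℝ → ENNReal) (p : ℝ) {q : ℝ} (hq : 0 < q) (a b : ℝ) :
    ∫⁻ x in Ioo (p - q * b) (p - q * a), f x =
      ENNReal.ofReal q * ∫⁻ t in Ioo a b, f (p - q * t) := by
  have him : (fun t => p - q * t) '' Ioo a b = Ioo (p - q * b) (p - q * a) := by
    ext y
    simp only [mem_image, mem_Ioo]
    constructor
    · rintro ⟨t, ⟨h1, h2⟩, rfl⟩
      constructor <;> nlinarith
    · rintro ⟨h1, h2⟩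
      refine ⟨(p - y) / q, ⟨?_, ?_⟩, by field_simp; ring⟩
      · rw [lt_div_iff₀ hq]; linarith
      · rw [div_lt_iff₀ hq]; linarith
  rw [← him, lintegral_image_eq_lintegral_abs_deriv_mul (f' := fun _ => -q) measurableSet_Ioo]
  · rw [lintegral_const_mul' _ _ (by simp), abs_neg, abs_of_pos hq]
  · intro x _
    simpa using (((hasDerivAt_id x).const_mul q).const_sub p).hasDerivWithinAt
  · intro x _ y _ h
    have : q * x = q * y := by simpa using h
    exact mul_left_cancel₀ hq.ne' this

lemma invSub (f : ℝ → ENNReal) {b : ℝ} (hb : 0 < b) :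
    ∫⁻ a in Ioo b 1, f a = ∫⁻ x in Ioo b 1, ENNReal.ofReal (b / x ^ 2) * f (b / x) := by
  have him : (fun t => b / t) '' Ioo b 1 = Ioo b 1 := by
    ext y
    simp only [mem_image, mem_Ioo]
    constructor
    · rintro ⟨t, ⟨h1, h2⟩, rfl⟩
      have : 0 < t := hb.trans h1
      constructor
      · rw [lt_div_iff₀ this]; nlinarith
      · rw [div_lt_iff₀ this]; linarith
    · rintro ⟨h1, h2⟩
      have : 0 < y := hb.trans h1
      refine ⟨b / y, ⟨?_, ?_⟩, by field_simp⟩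
      · rw [lt_div_iff₀ this]; nlinarith
      · rw [div_lt_iff₀ this]; linarith
  conv_lhs => rw [← him]
  rw [lintegral_image_eq_lintegral_abs_deriv_mul (f' := fun x => -(b / x^2)) measurableSet_Ioo]
  · refine setLIntegral_congr_fun measurableSet_Ioo fun x hx => ?_
    have : 0 < x := hb.trans hx.1
    simp only [abs_neg]
    rw [abs_of_pos (by positivity)]
  · intro x hx
    have : 0 < x := hb.trans hx.1
    have h := ((hasDerivAt_inv this.ne').const_mul b).hasDerivWithinAt (s := Ioo b 1)
    convert! h using 1
    field_simp
  · intro x hx y hy h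
    have h1 : 0 < x := hb.trans hx.1
    have h2 : 0 < y := hb.trans hy.1
    simp only at h
    field_simp at h
    exact h.symm

lemma lemC {f : ℝ → ℝ} {g : ℝ → ENNReal} {a b : ℝ} (hab : a ≤ b) (hg : Measurable g)
    (hfin : ∫⁻ x in Ioo a b, g x ≠ ⊤) (h : ∀ x ∈ Ioo a b, g x ≠ ⊤ → f x = (g x).toReal) :
    ∫ x in a..b, f x = (∫⁻ x in Ioo a b, g x).toReal := by
  have hae := ae_lt_top hg hfin
  rw [intervalIntegral.integral_of_le hab, integral_Ioc_eq_integral_Ioo,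
    ← integral_toReal hg.aemeasurable hae]
  apply integral_congr_ae
  filter_upwards [hae, ae_restrict_mem measurableSet_Ioo] with x hx hx2
  exact h x hx2 hx.ne

lemma lintOfReal {s : Set ℝ} {f : ℝ → ℝ} (hs : MeasurableSet s) (hf : IntegrableOn f s)
    (h0 : ∀ x ∈ s, 0 ≤ f x) : ∫⁻ x in s, ENNReal.ofReal (f x) = ENNReal.ofReal (∫ x in s, f x) := by
  rw [ofReal_integral_eq_lintegral_ofReal hf]
  filter_upwards [ae_restrict_mem hs] with x hx using h0 x hx

lemma lintPow0 {r w : ℝ} (hr : 0 < r) (hw : 0 < w) :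
    ∫⁻ x in Ioo 0 w, ENNReal.ofReal (x ^ (r - 1)) = ENNReal.ofReal (w ^ r / r) := by
  have hi : IntegrableOn (fun x : ℝ => x ^ (r - 1)) (Ioo 0 w) := by
    have := (intervalIntegral.intervalIntegrable_rpow' (a := 0) (b := w) (r := r - 1) (by linarith))
    exact ((intervalIntegrable_iff_integrableOn_Ioc_of_le hw.le).1 this).mono_set Ioo_subset_Ioc_self
  rw [lintOfReal measurableSet_Ioo hi (fun x hx => rpow_nonneg hx.1.le _),
    ← integral_Ioc_eq_integral_Ioo, ← intervalIntegral.integral_of_le hw.le,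
    integral_rpow (Or.inl (by linarith))]
  simp [zero_rpow hr.ne']

lemma lintPow1 {r w : ℝ} (hr : r ≠ 0) (hw : 0 < w) (hw1 : w < 1) :
    ∫⁻ x in Ioo w 1, ENNReal.ofReal (x ^ (r - 1)) = ENNReal.ofReal ((1 - w ^ r) / r) := by
  have h0 : (0:ℝ) ∉ uIcc w 1 := by
    rw [uIcc_of_le hw1.le]; intro h; linarith [h.1]
  have hi : IntegrableOn (fun x : ℝ => x ^ (r - 1)) (Ioo w 1) := by
    have := (intervalIntegral.intervalIntegrable_rpow (a := w) (b := 1) (r := r - 1) (μ := volume) (Or.inr h0))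
    exact ((intervalIntegrable_iff_integrableOn_Ioc_of_le hw1.le).1 this).mono_set Ioo_subset_Ioc_self
  rw [lintOfReal measurableSet_Ioo hi (fun x hx => rpow_nonneg (hw.trans hx.1).le _),
    ← integral_Ioc_eq_integral_Ioo, ← intervalIntegral.integral_of_le hw1.le,
    integral_rpow (Or.inr ⟨by intro h; apply hr; linarith, h0⟩)]
  simp

lemma lintBeta {p q : ℝ} (hp : 0 < p) (hq : 0 < q) :
    ∫⁻ x in Ioo 0 1, ENNReal.ofReal (x ^ (p - 1) * (1 - x) ^ (q - 1)) =
      ENNReal.ofReal (ProbabilityTheory.beta p q) := by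
  have hb := ProbabilityTheory.beta_pos hp hq
  have h := ProbabilityTheory.lintegral_betaPDF_eq_one hp hq
  rw [ProbabilityTheory.lintegral_betaPDF] at h
  have h2 : ∀ x : ℝ, ENNReal.ofReal (1 / ProbabilityTheory.beta p q * x ^ (p - 1) * (1 - x) ^ (q - 1)) =
      ENNReal.ofReal (1 / ProbabilityTheory.beta p q) * ENNReal.ofReal (x ^ (p - 1) * (1 - x) ^ (q - 1)) := by
    intro x
    rw [← ENNReal.ofReal_mul (by positivity), mul_assoc]
  simp_rw [h2] at h
  rw [lintegral_const_mul' _ _ (by simp)] at h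
  have h3 := congrArg (fun z => ENNReal.ofReal (ProbabilityTheory.beta p q) * z) h
  simp only [← mul_assoc] at h3
  rw [← ENNReal.ofReal_mul hb.le, mul_one_div_cancel hb.ne'] at h3
  simpa using h3

lemma intBeta {p q : ℝ} (hp : 0 < p) (hq : 0 < q) :
    IntegrableOn (fun x : ℝ => x ^ (p - 1) * (1 - x) ^ (q - 1)) (Ioo 0 1) ∧
    ∫ x in Ioo (0:ℝ) 1, x ^ (p - 1) * (1 - x) ^ (q - 1) = ProbabilityTheory.beta p q := by
  have h := lintBeta hp hq
  have hn : 0 ≤ᵐ[volume.restrict (Ioo (0:ℝ) 1)] fun x : ℝ => x ^ (p - 1) * (1 - x) ^ (q - 1) := by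
    filter_upwards [ae_restrict_mem measurableSet_Ioo] with x hx
    exact mul_nonneg (rpow_nonneg hx.1.le _) (rpow_nonneg (by linarith [hx.2]) _)
  have hm : Measurable fun x : ℝ => x ^ (p - 1) * (1 - x) ^ (q - 1) := by fun_prop
  constructor
  · refine ⟨hm.aestronglyMeasurable, ?_⟩
    rw [hasFiniteIntegral_iff_ofReal hn, h]
    exact ENNReal.ofReal_lt_top
  · rw [integral_eq_lintegral_of_nonneg_ae hn hm.aestronglyMeasurable, h,
      ENNReal.toReal_ofReal (ProbabilityTheory.beta_pos hp hq).le]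

/-- coefficients of `(1-x)^(-d)` -/
noncomputable def bc (d : ℝ) (k : ℕ) : ℝ := poch d k / (Nat.factorial k : ℝ)

lemma poch_succ (a : ℝ) (k : ℕ) : poch a (k + 1) = poch a k * (a + k) := by
  simp [poch, Finset.prod_range_succ]

lemma poch_zero (a : ℝ) : poch a 0 = 1 := by simp [poch]

lemma poch_pos {a : ℝ} (ha : 0 < a) (k : ℕ) : 0 < poch a k :=
  Finset.prod_pos fun i _ => by positivity

lemma bc_nonneg {d : ℝ} (hd : 0 < d) (k : ℕ) : 0 ≤ bc d k := by
  have := poch_pos hd k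
  unfold bc; positivity

lemma choose_bc (d : ℝ) (k : ℕ) : Ring.choose (d + k - 1) k = bc d k := by
  have h := Ring.descPochhammer_eq_factorial_smul_choose (d + k - 1) k
  rw [Polynomial.descPochhammer_smeval_eq_ascPochhammer, Polynomial.ascPochhammer_smeval_eq_eval] at h
  rw [show d + k - 1 - k + 1 = d by ring] at h
  have h2 : Polynomial.eval d (ascPochhammer ℝ k) = poch d k := by
    clear h
    induction k with
    | zero => simp [poch]
    | succ k ih => rw [ascPochhammer_succ_eval, ih, poch_succ]
  rw [h2] at h
  rw [bc, h]
  have : (k.factorial : ℝ) ≠ 0 := by positivity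
  field_simp
  simp [mul_comm]

lemma hasSum_bc (d : ℝ) {x : ℝ} (hx0 : 0 ≤ x) (hx : x < 1) :
    HasSum (fun k => bc d k * x ^ k) ((1 - x) ^ (-d)) := by
  have h := (Real.one_div_one_sub_rpow_hasFPowerSeriesOnBall_zero d).hasSum (y := x) (by
    simp [enorm_eq_nnnorm]
    rw [← NNReal.coe_lt_coe]; simpa [abs_of_nonneg hx0] using hx)
  have h1 : (1 - x) ^ (-d) = 1 / (1 - (0 + x)) ^ d := by
    rw [rpow_neg (by linarith), zero_add, one_div]
  rw [h1]
  convert! h using 2 with k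
  rw [FormalMultilinearSeries.ofScalars_apply_eq, choose_bc, smul_eq_mul]

noncomputable def fE (d y1 y2 y3 y4 y5 : ℝ) : ENNReal :=
  ENNReal.ofReal ((y1 - y3) ^ (-d) * (y3 - y4) ^ (-d) * (y2 - y4) ^ (-d) * (y2 - y5) ^ (-d) * (y1 - y5) ^ (-d))

lemma fE_meas (d : ℝ) {α : Type*} [MeasurableSpace α] {a b c e g : α → ℝ} (ha : Measurable a)
    (hb : Measurable b) (hc : Measurable c) (he : Measurable e) (hg : Measurable g) :
    Measurable fun x => fE d (a x) (b x) (c x) (e x) (g x) := by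
  unfold fE
  fun_prop

noncomputable def E5 (d : ℝ) : ENNReal :=
  ∫⁻ y1 in Ioo 0 1, ∫⁻ y2 in Ioo 0 y1, ∫⁻ y3 in Ioo 0 y2, ∫⁻ y4 in Ioo 0 y3, ∫⁻ y5 in Ioo 0 y4,
    fE d y1 y2 y3 y4 y5

lemma int_eq (d : ℝ) (h : E5 d ≠ ⊤) :
    (∫ y1 in (0:ℝ)..1, ∫ y2 in (0:ℝ)..y1, ∫ y3 in (0:ℝ)..y2, ∫ y4 in (0:ℝ)..y3, ∫ y5 in (0:ℝ)..y4,
      (y1 - y3) ^ (-d) * (y3 - y4) ^ (-d) * (y2 - y4) ^ (-d) * (y2 - y5) ^ (-d) * (y1 - y5) ^ (-d)) =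
    (E5 d).toReal := by
  unfold E5 at h ⊢
  refine lemC zero_le_one ?_ h fun y1 hy1 h1 => ?_
  · repeat' first | (apply fE_meas <;> fun_prop) | ((try simp only [Function.uncurry_def]); apply measM) | fun_prop
  refine lemC hy1.1.le ?_ h1 fun y2 hy2 h2 => ?_
  · repeat' first | (apply fE_meas <;> fun_prop) | ((try simp only [Function.uncurry_def]); apply measM) | fun_prop
  refine lemC hy2.1.le ?_ h2 fun y3 hy3 h3 => ?_
  · repeat' first | (apply fE_meas <;> fun_prop) | ((try simp only [Function.uncurry_def]); apply measM) | fun_prop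
  refine lemC hy3.1.le ?_ h3 fun y4 hy4 h4 => ?_
  · repeat' first | (apply fE_meas <;> fun_prop) | ((try simp only [Function.uncurry_def]); apply measM) | fun_prop
  refine lemC hy4.1.le ?_ h4 fun y5 hy5 h5 => ?_
  · apply fE_meas <;> fun_prop
  unfold fE
  rw [ENNReal.toReal_ofReal]
  have := hy1.2
  have := hy2.2
  have := hy3.2
  have := hy4.2
  have := hy5.2
  refine mul_nonneg (mul_nonneg (mul_nonneg (mul_nonneg ?_ ?_) ?_) ?_) ?_ <;>
    exact rpow_nonneg (by linarith) _

noncomputable def JE (d : ℝ) : ENNReal :=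
  ∫⁻ a in Ioo 0 1, ∫⁻ b in Ioo 0 a, ∫⁻ c in Ioo 0 b,
    ENNReal.ofReal ((1 - b) ^ (-d) * (b - c) ^ (-d) * (a - c) ^ (-d) * a ^ (-d))

lemma E5_eq {d : ℝ} (h0 : 0 < d) (h1 : d < 1/2) :
    E5 d = ENNReal.ofReal (1 / ((4 - 5 * d) * (5 - 5 * d))) * JE d := by
  have hA : E5 d = ∫⁻ y1 in Ioo 0 1, ∫⁻ y5 in Ioo 0 y1, ∫⁻ y2 in Ioo y5 y1, ∫⁻ y3 in Ioo y5 y2,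
      ∫⁻ y4 in Ioo y5 y3, fE d y1 y2 y3 y4 y5 := by
    unfold E5
    refine lintegral_congr fun y1 => ?_
    rw [← triSwap]
    swap
    · repeat' first | (apply fE_meas <;> fun_prop) | ((try simp only [Function.uncurry_def]); apply measM) | fun_prop
    refine lintegral_congr fun y2 => ?_
    rw [← triSwap]
    swap
    · repeat' first | (apply fE_meas <;> fun_prop) | ((try simp only [Function.uncurry_def]); apply measM) | fun_prop
    refine lintegral_congr fun y3 => ?_
    rw [← triSwap]
    repeat' first | (apply fE_meas <;> fun_prop) | ((try simp only [Function.uncurry_def]); apply measM) | fun_prop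
  have hB : ∀ y1 y5 : ℝ, y5 < y1 → ∫⁻ y2 in Ioo y5 y1, ∫⁻ y3 in Ioo y5 y2,
      ∫⁻ y4 in Ioo y5 y3, fE d y1 y2 y3 y4 y5 = ENNReal.ofReal ((y1 - y5) ^ (3 - 5 * d)) * JE d := by
    intro y1 y5 hy
    have hL : 0 < y1 - y5 := by linarith
    set L := y1 - y5 with hLdef
    have hsub : ∀ (f : ℝ → ENNReal) (x : ℝ), ∫⁻ y in Ioo y5 (y5 + L * x), f y =
        ENNReal.ofReal L * ∫⁻ t in Ioo 0 x, f (y5 + L * t) := by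
      intro f x
      have := affSub f y5 hL 0 x
      simpa using this
    have hy1 : y1 = y5 + L * 1 := by rw [hLdef]; ring
    have e1 : ∫⁻ y2 in Ioo y5 y1, ∫⁻ y3 in Ioo y5 y2, ∫⁻ y4 in Ioo y5 y3, fE d y1 y2 y3 y4 y5 =
      ∫⁻ y2 in Ioo y5 (y5 + L * 1), ∫⁻ y3 in Ioo y5 y2, ∫⁻ y4 in Ioo y5 y3, fE d y1 y2 y3 y4 y5 := by
      rw [← hy1]
    rw [e1, hsub]
    simp_rw [hsub]
    have hJ : ∀ a b c : ℝ, a ∈ Ioo 0 1 → b ∈ Ioo 0 a → c ∈ Ioo 0 b →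
        fE d y1 (y5 + L * a) (y5 + L * b) (y5 + L * c) y5 = ENNReal.ofReal (L ^ (- 5 * d)) *
        ENNReal.ofReal ((1 - b) ^ (-d) * (b - c) ^ (-d) * (a - c) ^ (-d) * a ^ (-d)) := by
      intro a b c ha hb hc
      rw [← ENNReal.ofReal_mul (by positivity)]
      unfold fE
      congr 1
      rw [show y1 - (y5 + L * b) = L * (1 - b) by rw [hLdef]; ring,
        show y5 + L * b - (y5 + L * c) = L * (b - c) by ring,
        show y5 + L * a - (y5 + L * c) = L * (a - c) by ring,
        show y5 + L * a - y5 = L * a by ring, ← hLdef,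
        mul_rpow hL.le (by linarith [hb.2, ha.2]), mul_rpow hL.le (by linarith [hc.2]),
        mul_rpow hL.le (by linarith [hb.2, hc.2]), mul_rpow hL.le (by linarith [ha.1])]
      rw [show (-5 * d : ℝ) = -d + -d + -d + -d + -d by ring]
      simp only [rpow_add hL]
      ring
    have e2 : ∫⁻ a in Ioo 0 1, ENNReal.ofReal L * ∫⁻ b in Ioo 0 a, ENNReal.ofReal L *
        ∫⁻ c in Ioo 0 b, fE d y1 (y5 + L * a) (y5 + L * b) (y5 + L * c) y5 =
        ENNReal.ofReal L * (ENNReal.ofReal L * (ENNReal.ofReal (L ^ (- 5 * d)) * JE d)) := by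
      unfold JE
      rw [← lintegral_const_mul' _ _ (by simp), ← lintegral_const_mul' _ _ (by simp),
        ← lintegral_const_mul' _ _ (by simp)]
      refine setLIntegral_congr_fun measurableSet_Ioo fun a ha => ?_
      beta_reduce
      congr 1
      rw [← lintegral_const_mul' _ _ (by simp), ← lintegral_const_mul' _ _ (by simp)]
      refine setLIntegral_congr_fun measurableSet_Ioo fun b hb => ?_
      beta_reduce
      congr 1
      rw [← lintegral_const_mul' _ _ (by simp)]
      refine setLIntegral_congr_fun measurableSet_Ioo fun c hc => ?_
      exact hJ a b c ha hb hc
    rw [e2]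
    simp only [← mul_assoc]
    congr 1
    rw [← ENNReal.ofReal_mul hL.le, ← ENNReal.ofReal_mul (by positivity), ← ENNReal.ofReal_mul (by positivity)]
    congr 1
    rw [show (3 - 5 * d : ℝ) = 1 + 1 + 1 + -5 * d by ring]
    simp only [rpow_add hL, rpow_one]
  have hC : ∀ y1 ∈ Ioo (0:ℝ) 1, ∫⁻ y5 in Ioo 0 y1, ENNReal.ofReal ((y1 - y5) ^ (3 - 5 * d)) =
      ENNReal.ofReal (y1 ^ (4 - 5 * d) / (4 - 5 * d)) := by
    intro y1 hy1
    have := reflSub (fun x => ENNReal.ofReal (x ^ (3 - 5 * d))) y1 one_pos 0 y1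
    simp only [one_mul, sub_self, sub_zero, ENNReal.ofReal_one] at this
    rw [← this, show 3 - 5 * d = (4 - 5 * d) - 1 by ring, lintPow0 (by linarith) hy1.1]
  rw [hA]
  have hD : ∀ y1 ∈ Ioo (0:ℝ) 1, ∫⁻ y5 in Ioo 0 y1, ∫⁻ y2 in Ioo y5 y1, ∫⁻ y3 in Ioo y5 y2,
      ∫⁻ y4 in Ioo y5 y3, fE d y1 y2 y3 y4 y5 =
      ENNReal.ofReal (1 / (4 - 5 * d)) * ENNReal.ofReal (y1 ^ ((5 - 5 * d) - 1)) * JE d := by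
    intro y1 hy1
    rw [setLIntegral_congr_fun measurableSet_Ioo (fun y5 hy5 => hB y1 y5 hy5.2),
      lintegral_mul_const _ (by fun_prop), hC y1 hy1, ← ENNReal.ofReal_mul (by
        apply one_div_nonneg.2; linarith)]
    congr 2
    rw [show 5 - 5 * d - 1 = 4 - 5 * d by ring]; ring
  rw [setLIntegral_congr_fun measurableSet_Ioo hD, lintegral_mul_const _ (by fun_prop),
    lintegral_const_mul _ (by fun_prop), lintPow0 (by linarith) one_pos, ← ENNReal.ofReal_mul (by
        apply one_div_nonneg.2; linarith), one_rpow]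
  congr 2
  rw [one_div_mul_one_div]

open ProbabilityTheory (beta beta_pos)

noncomputable def ac (d : ℝ) (k : ℕ) : ℝ := poch d k / (poch (2 - d) k * (1 - d))

noncomputable def Fs (d x : ℝ) : ENNReal := ∑' k : ℕ, ENNReal.ofReal (ac d k * x ^ k)

lemma Gamma_poch {a : ℝ} (ha : 0 < a) (k : ℕ) : Gamma (a + k) = poch a k * Gamma a := by
  induction k with
  | zero => simp [poch]
  | succ k ih =>
    rw [poch_succ, Nat.cast_succ, ← add_assoc, Gamma_add_one (by positivity), ih]
    ring

lemma bcBeta (d : ℝ) {q : ℝ} (hq : 0 < q) (k : ℕ) :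
    bc d k * beta (k + 1) q = poch d k / (poch (q + 1) k * q) := by
  unfold bc beta
  rw [Gamma_nat_eq_factorial, show (k + 1 + q : ℝ) = (q + 1) + k by ring, Gamma_poch (by linarith),
    Gamma_add_one hq.ne']
  have h1 := Gamma_pos_of_pos hq
  have h2 := poch_pos (a := q + 1) (by linarith) k
  have h3 : (0:ℝ) < k.factorial := by positivity
  field_simp

lemma ac_nonneg {d : ℝ} (h0 : 0 < d) (h1 : d < 1/2) (k : ℕ) : 0 ≤ ac d k := by
  have := poch_pos h0 k
  have := poch_pos (a := 2 - d) (by linarith) k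
  have : 0 < 1 - d := by linarith
  unfold ac; positivity

lemma ac_eq {d : ℝ} (h1 : d < 1/2) (k : ℕ) : bc d k * beta (k + 1) (1 - d) = ac d k := by
  rw [bcBeta d (by linarith), ac, show 1 - d + 1 = 2 - d by ring]

lemma ofReal_series {d : ℝ} (h0 : 0 < d) {x : ℝ} (hx0 : 0 ≤ x) (hx : x < 1) :
    ENNReal.ofReal ((1 - x) ^ (-d)) = ∑' k, ENNReal.ofReal (bc d k * x ^ k) := by
  have h := hasSum_bc d hx0 hx
  rw [← h.tsum_eq, ENNReal.ofReal_tsum_of_nonneg _ h.summable]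
  intro k
  exact mul_nonneg (bc_nonneg h0 k) (pow_nonneg hx0 k)

lemma Fs_eq {d : ℝ} (h0 : 0 < d) (h1 : d < 1/2) {x : ℝ} (hx0 : 0 < x) (hx : x < 1) :
    ∫⁻ t in Ioo 0 1, ENNReal.ofReal ((1 - t) ^ (-d) * (1 - x * t) ^ (-d)) = Fs d x := by
  have e : ∀ t ∈ Ioo (0:ℝ) 1, ENNReal.ofReal ((1 - t) ^ (-d) * (1 - x * t) ^ (-d)) =
      ∑' k : ℕ, ENNReal.ofReal (bc d k * x ^ k) *
        ENNReal.ofReal (t ^ ((k + 1 : ℝ) - 1) * (1 - t) ^ ((1 - d) - 1)) := by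
    intro t ht
    have h2 : x * t < 1 := by nlinarith [ht.1, ht.2]
    rw [ENNReal.ofReal_mul (rpow_nonneg (by linarith [ht.2]) _),
      ofReal_series h0 (mul_nonneg hx0.le ht.1.le) h2, ← ENNReal.tsum_mul_left]
    refine tsum_congr fun k => ?_
    have := bc_nonneg h0 k
    have := ht.1
    have : 0 ≤ 1 - t := by linarith [ht.2]
    rw [← ENNReal.ofReal_mul (by positivity), ← ENNReal.ofReal_mul (by positivity)]
    congr 1
    rw [show (k + 1 : ℝ) - 1 = k by ring, rpow_natCast, show 1 - d - 1 = -d by ring, mul_pow]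
    ring
  rw [setLIntegral_congr_fun measurableSet_Ioo e, lintegral_tsum (fun k => by fun_prop)]
  unfold Fs
  refine tsum_congr fun k => ?_
  have := bc_nonneg h0 k
  rw [lintegral_const_mul _ (by fun_prop), lintBeta (by positivity) (by linarith),
    ← ENNReal.ofReal_mul (by positivity), ← ac_eq h1]
  congr 1
  ring

lemma Gterm {p q r : ℝ} (hp : 0 < p) (hq : 0 < q) (hr : r ≠ 0) (hpr : 0 < p + r) :
    0 ≤ (beta p q - beta (p + r) q) / r ∧
    ∫⁻ w in Ioo 0 1, ENNReal.ofReal (w ^ (p - 1) * (1 - w) ^ (q - 1)) *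
      ENNReal.ofReal ((1 - w ^ r) / r) = ENNReal.ofReal ((beta p q - beta (p + r) q) / r) := by
  obtain ⟨i1, j1⟩ := intBeta hp hq
  obtain ⟨i2, j2⟩ := intBeta hpr hq
  have hnn : ∀ w ∈ Ioo (0:ℝ) 1, 0 ≤ (1 - w ^ r) / r := by
    intro w hw
    rcases lt_or_gt_of_ne hr with h | h
    · apply div_nonneg_of_nonpos _ h.le
      have := one_le_rpow_of_pos_of_le_one_of_nonpos hw.1 hw.2.le h.le
      linarith
    · apply div_nonneg _ h.le
      have := rpow_le_one hw.1.le hw.2.le h.le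
      linarith
  have e : ∀ w ∈ Ioo (0:ℝ) 1, (w ^ (p - 1) * (1 - w) ^ (q - 1)) * ((1 - w ^ r) / r) =
      (w ^ (p - 1) * (1 - w) ^ (q - 1) - w ^ (p + r - 1) * (1 - w) ^ (q - 1)) / r := by
    intro w hw
    rw [show p + r - 1 = (p - 1) + r by ring, rpow_add hw.1]
    ring
  have hpos : ∀ w ∈ Ioo (0:ℝ) 1, 0 ≤ w ^ (p - 1) * (1 - w) ^ (q - 1) := fun w hw =>
    mul_nonneg (rpow_nonneg hw.1.le _) (rpow_nonneg (by linarith [hw.2]) _)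
  have hn : ∀ w ∈ Ioo (0:ℝ) 1,
      0 ≤ (w ^ (p - 1) * (1 - w) ^ (q - 1) - w ^ (p + r - 1) * (1 - w) ^ (q - 1)) / r := by
    intro w hw
    rw [← e w hw]
    exact mul_nonneg (hpos w hw) (hnn w hw)
  have hI : ∫ w in Ioo (0:ℝ) 1, (w ^ (p - 1) * (1 - w) ^ (q - 1) - w ^ (p + r - 1) * (1 - w) ^ (q - 1)) / r =
      (beta p q - beta (p + r) q) / r := by
    rw [integral_div, integral_sub i1 i2, j1, j2]
  constructor
  · rw [← hI]
    exact setIntegral_nonneg measurableSet_Ioo hn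
  · have hl := lintOfReal (f := fun w : ℝ => (w ^ (p - 1) * (1 - w) ^ (q - 1) -
      w ^ (p + r - 1) * (1 - w) ^ (q - 1)) / r) measurableSet_Ioo ((i1.sub i2).div_const r) hn
    rw [← hI, ← hl]
    refine setLIntegral_congr_fun measurableSet_Ioo fun w hw => ?_
    beta_reduce
    rw [← e w hw, ENNReal.ofReal_mul (hpos w hw)]

lemma lemG {c : ℕ → ℝ} (hc : ∀ k, 0 ≤ c k) {p q r : ℝ} (hp : 0 < p) (hq : 0 < q)
    (hr : ∀ k : ℕ, r + k ≠ 0) (hpr : 0 < p + r) :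
    ∫⁻ w in Ioo 0 1, ENNReal.ofReal (w ^ (p - 1) * (1 - w) ^ (q - 1)) *
      ∫⁻ u in Ioo w 1, ENNReal.ofReal (u ^ (r - 1)) * ∑' k : ℕ, ENNReal.ofReal (c k * u ^ k) =
    ∑' k : ℕ, ENNReal.ofReal (c k * ((beta p q - beta (p + (r + k)) q) / (r + k))) := by
  have hin : ∀ w ∈ Ioo (0:ℝ) 1, ENNReal.ofReal (w ^ (p - 1) * (1 - w) ^ (q - 1)) *
      ∫⁻ u in Ioo w 1, ENNReal.ofReal (u ^ (r - 1)) * ∑' k : ℕ, ENNReal.ofReal (c k * u ^ k) =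
      ∑' k : ℕ, ENNReal.ofReal (c k) * (ENNReal.ofReal (w ^ (p - 1) * (1 - w) ^ (q - 1)) *
        ENNReal.ofReal ((1 - w ^ (r + k)) / (r + k))) := by
    intro w hw
    have e : ∀ u ∈ Ioo w 1, ENNReal.ofReal (u ^ (r - 1)) * ∑' k : ℕ, ENNReal.ofReal (c k * u ^ k) =
        ∑' k : ℕ, ENNReal.ofReal (c k) * ENNReal.ofReal (u ^ ((r + k) - 1)) := by
      intro u hu
      have hu0 : 0 < u := hw.1.trans hu.1
      rw [← ENNReal.tsum_mul_left]
      refine tsum_congr fun k => ?_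
      rw [← ENNReal.ofReal_mul (by positivity), ← ENNReal.ofReal_mul (hc k),
        show r + k - 1 = (r - 1) + k by ring, rpow_add hu0, rpow_natCast]
      congr 1
      ring
    rw [setLIntegral_congr_fun measurableSet_Ioo e, lintegral_tsum (fun k => by fun_prop),
      ← ENNReal.tsum_mul_left]
    refine tsum_congr fun k => ?_
    rw [lintegral_const_mul _ (by fun_prop), lintPow1 (hr k) hw.1 hw.2]
    ring
  rw [setLIntegral_congr_fun measurableSet_Ioo hin, lintegral_tsum (fun k => by fun_prop)]
  refine tsum_congr fun k => ?_
  have hk : 0 < p + (r + k) := by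
    have : (0:ℝ) ≤ k := by positivity
    linarith
  rw [lintegral_const_mul _ (by fun_prop), (Gterm hp hq (hr k) hk).2, ENNReal.ofReal_mul (hc k)]

lemma Fs_meas (d : ℝ) : Measurable (Fs d) := by
  unfold Fs
  fun_prop

lemma JE_eq {d : ℝ} (h0 : 0 < d) (h1 : d < 1/2) :
    JE d = ∫⁻ b in Ioo 0 1, ENNReal.ofReal (b ^ ((3 - 3 * d) - 1) * (1 - b) ^ ((1 - d) - 1)) *
      ∫⁻ x in Ioo b 1, ENNReal.ofReal (x ^ ((2 * d - 1) - 1)) * Fs d x := by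
  unfold JE
  rw [triSwap]
  swap
  · (try simp only [Function.uncurry_def]); apply measM <;> fun_prop
  refine setLIntegral_congr_fun measurableSet_Ioo fun b hb => ?_
  have hb0 := hb.1
  have hb1 : 0 < 1 - b := by linarith [hb.2]
  have e1 : ∀ a ∈ Ioo b 1, ∫⁻ c in Ioo 0 b,
      ENNReal.ofReal ((1 - b) ^ (-d) * (b - c) ^ (-d) * (a - c) ^ (-d) * a ^ (-d)) =
      ENNReal.ofReal (b ^ (1 - d) * (1 - b) ^ (-d) * a ^ (-2 * d)) * Fs d (b / a) := by
    intro a ha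
    have ha0 : 0 < a := hb0.trans ha.1
    have := affSub (fun c => ENNReal.ofReal ((1 - b) ^ (-d) * (b - c) ^ (-d) * (a - c) ^ (-d) * a ^ (-d)))
      0 hb0 0 1
    simp only [zero_add, mul_zero, mul_one] at this
    rw [this, ← Fs_eq h0 h1 (div_pos hb0 ha0) ((div_lt_one ha0).2 ha.1),
      ← lintegral_const_mul _ (by fun_prop), ← lintegral_const_mul _ (by fun_prop)]
    refine setLIntegral_congr_fun measurableSet_Ioo fun t ht => ?_
    have ht1 : 0 < 1 - t := by linarith [ht.2]
    have hq : 0 < 1 - b / a * t := by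
      have : b / a < 1 := (div_lt_one ha0).2 ha.1
      nlinarith [ht.1, ht.2]
    beta_reduce
    rw [← ENNReal.ofReal_mul (by positivity), ← ENNReal.ofReal_mul (by positivity)]
    congr 1
    rw [show b - b * t = b * (1 - t) by ring, show a - b * t = a * (1 - b / a * t) by field_simp,
      mul_rpow hb0.le ht1.le, mul_rpow ha0.le hq.le, show 1 - d = 1 + -d by ring,
      show -2 * d = -d + -d by ring, rpow_add hb0, rpow_add ha0, rpow_one]
    ring
  rw [setLIntegral_congr_fun measurableSet_Ioo e1, invSub _ hb0, ← lintegral_const_mul]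
  swap
  · have := Fs_meas d; fun_prop
  refine setLIntegral_congr_fun measurableSet_Ioo fun x hx => ?_
  have hx0 : 0 < x := hb0.trans hx.1
  beta_reduce
  rw [show b / (b / x) = x by field_simp, ← mul_assoc, ← mul_assoc, ← ENNReal.ofReal_mul (by positivity),
    ← ENNReal.ofReal_mul (by positivity)]
  congr 2
  rw [div_rpow hb0.le hx0.le, show (3 - 3 * d - 1) = 1 + (1 - d) + (-2 * d) by ring,
    show 1 - d - 1 = -d by ring, show 2 * d - 1 - 1 = -(-2 * d) + -(2:ℕ) by push_cast; ring,
    rpow_add hx0, rpow_add hb0, rpow_add hb0, rpow_one, rpow_neg hx0.le (-2 * d), rpow_neg hx0.le ((2:ℕ):ℝ), rpow_natCast]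
  ring

lemma X_eq {d : ℝ} (h0 : 0 < d) (h1 : d < 1/2) :
    ∫⁻ w in Ioo 0 1, ENNReal.ofReal (w ^ ((2 - 2 * d) - 1) * (1 - w) ^ ((2 - 2 * d) - 1)) *
      ∫⁻ u in Ioo w 1, ENNReal.ofReal (u ^ ((2 * d - 1) - 1)) * ∑' k : ℕ, ENNReal.ofReal (bc d k * u ^ k) =
    ∑' k : ℕ, ENNReal.ofReal (ac d k / (k + (3 - 3 * d))) := by
  have e1 : ∀ w ∈ Ioo (0:ℝ) 1, ENNReal.ofReal (w ^ ((2 - 2 * d) - 1) * (1 - w) ^ ((2 - 2 * d) - 1)) *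
      ∫⁻ u in Ioo w 1, ENNReal.ofReal (u ^ ((2 * d - 1) - 1)) * ∑' k : ℕ, ENNReal.ofReal (bc d k * u ^ k) =
      ENNReal.ofReal ((1 - w) ^ (2 - 3 * d)) * Fs d (1 - w) := by
    intro w hw
    have hw0 := hw.1
    have hw1 : 0 < 1 - w := by linarith [hw.2]
    have e2 : ∀ u ∈ Ioo w 1, ENNReal.ofReal (u ^ ((2 * d - 1) - 1)) * ∑' k : ℕ, ENNReal.ofReal (bc d k * u ^ k) =
        ENNReal.ofReal (u ^ (2 * d - 2) * (1 - u) ^ (-d)) := by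
      intro u hu
      have hu0 : 0 < u := hw0.trans hu.1
      rw [← ofReal_series h0 hu0.le hu.2, ← ENNReal.ofReal_mul (by positivity)]
      congr 3
      ring
    rw [setLIntegral_congr_fun measurableSet_Ioo e2, invSub _ hw0]
    have := reflSub (fun x => ENNReal.ofReal (w / x ^ 2) *
      ENNReal.ofReal ((w / x) ^ (2 * d - 2) * (1 - w / x) ^ (-d))) 1 hw1 0 1
    rw [show 1 - (1 - w) * 1 = w by ring, show 1 - (1 - w) * 0 = 1 by ring] at this
    rw [this, ← Fs_eq h0 h1 hw1 (by linarith), ← lintegral_const_mul _ (by fun_prop),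
      ← lintegral_const_mul _ (by fun_prop), ← lintegral_const_mul _ (by fun_prop)]
    refine setLIntegral_congr_fun measurableSet_Ioo fun s hs => ?_
    beta_reduce
    have hs1 : 0 < 1 - s := by linarith [hs.2]
    have hY : 0 < 1 - (1 - w) * s := by nlinarith [hs.1, hs.2]
    have hYw : 1 - w / (1 - (1 - w) * s) = (1 - w) * (1 - s) / (1 - (1 - w) * s) := by
      field_simp; ring
    rw [hYw]
    rw [← ENNReal.ofReal_mul (by positivity), ← ENNReal.ofReal_mul (by positivity),
      ← ENNReal.ofReal_mul (by positivity), ← ENNReal.ofReal_mul (by positivity)]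
    congr 1
    generalize hYd : 1 - (1 - w) * s = Y at *
    rw [div_rpow hw0.le hY.le, div_rpow (by positivity) hY.le, mul_rpow hw1.le hs1.le,
      show 2 - 2 * d - 1 = (1:ℕ) + (-(d + d)) + (0:ℝ) by push_cast; ring, 
      show 2 * d - 2 = d + d - (2:ℕ) by push_cast; ring,
      show 2 - 3 * d = (2:ℕ) + (-(d + d)) + (- d) by push_cast; ring]
    simp only [rpow_add hw0, rpow_add hw1, rpow_add hY, rpow_sub hw0, rpow_sub hY, rpow_natCast,
      rpow_neg hw0.le, rpow_neg hw1.le, rpow_neg hY.le, rpow_zero]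
    have p1 := rpow_pos_of_pos hw0 d
    have p2 := rpow_pos_of_pos hw1 d
    have p3 := rpow_pos_of_pos hY d
    field_simp
  rw [setLIntegral_congr_fun measurableSet_Ioo e1]
  have := reflSub (fun x => ENNReal.ofReal (x ^ (2 - 3 * d)) * Fs d x) 1 one_pos 0 1
  simp only [one_mul, mul_zero, mul_one, sub_self, sub_zero, ENNReal.ofReal_one] at this
  rw [← this]
  have e3 : ∀ x ∈ Ioo (0:ℝ) 1, ENNReal.ofReal (x ^ (2 - 3 * d)) * Fs d x =
      ∑' k : ℕ, ENNReal.ofReal (ac d k) * ENNReal.ofReal (x ^ ((k + (3 - 3 * d)) - 1)) := by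
    intro x hx
    have hx0 := hx.1
    unfold Fs
    rw [← ENNReal.tsum_mul_left]
    refine tsum_congr fun k => ?_
    rw [← ENNReal.ofReal_mul (by positivity), ← ENNReal.ofReal_mul (ac_nonneg h0 h1 k),
      show k + (3 - 3 * d) - 1 = (2 - 3 * d) + k by ring, rpow_add hx0, rpow_natCast]
    congr 1
    ring
  rw [setLIntegral_congr_fun measurableSet_Ioo e3, lintegral_tsum (fun k => by fun_prop)]
  refine tsum_congr fun k => ?_
  have : (0:ℝ) ≤ k := by positivity
  rw [lintegral_const_mul _ (by fun_prop), lintPow0 (by linarith) one_pos,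
    ← ENNReal.ofReal_mul (ac_nonneg h0 h1 k), one_rpow, mul_one_div]

lemma poch_one (k : ℕ) : poch 1 k = (k.factorial : ℝ) := by
  induction k with
  | zero => simp [poch]
  | succ k ih => rw [poch_succ, ih, Nat.factorial_succ]; push_cast; ring

lemma poch_shift (x : ℝ) (k : ℕ) : poch x k * (x + k) = x * poch (x + 1) k := by
  induction k with
  | zero => simp [poch]
  | succ k ih =>
    rw [poch_succ, ih, poch_succ]; push_cast; ring

lemma bc_zero (d : ℝ) : bc d 0 = 1 := by simp [bc, poch]

lemma bc_succ (d : ℝ) (k : ℕ) : bc d (k + 1) * (k + 1) = bc d k * (d + k) := by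
  unfold bc
  rw [poch_succ, Nat.factorial_succ]
  push_cast
  have : (0:ℝ) < k.factorial := by positivity
  field_simp

lemma bc_sq {d : ℝ} (h0 : 0 < d) (h1 : d < 1/2) (k : ℕ) : bc d k ^ 2 ≤ 1 / (2 * k + 1) := by
  induction k with
  | zero => simp [bc_zero]
  | succ k ih =>
    have hs := bc_succ d k
    have hb := bc_nonneg h0 k
    have hk : (0:ℝ) ≤ k := by positivity
    have e : bc d (k + 1) = bc d k * ((d + k) / (k + 1)) := by field_simp; linarith
    rw [e, mul_pow]
    have h2 : ((d + k) / (k + 1)) ^ 2 ≤ ((k + 1/2) / (k + 1 : ℝ)) ^ 2 := by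
      exact pow_le_pow_left₀ (by positivity) (div_le_div_of_nonneg_right (by linarith) (by positivity)) 2
    calc _ ≤ 1 / (2 * k + 1) * ((k + 1/2) / (k + 1 : ℝ)) ^ 2 := by gcongr
      _ ≤ _ := by
        push_cast
        rw [div_pow, div_mul_div_comm, div_le_div_iff₀ (by positivity) (by positivity)]
        nlinarith [mul_nonneg hk hk, mul_nonneg hk (mul_nonneg hk hk)]

lemma bc_tendsto {d : ℝ} (h0 : 0 < d) (h1 : d < 1/2) :
    Filter.Tendsto (bc d) Filter.atTop (nhds 0) := by
  have h : Filter.Tendsto (fun k => bc d k ^ 2) Filter.atTop (nhds 0) := by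
    refine squeeze_zero (fun k => sq_nonneg _) (fun k => (bc_sq h0 h1 k).trans ?_)
      tendsto_one_div_add_atTop_nhds_zero_nat
    gcongr
    have : (0:ℝ) ≤ k := by positivity
    linarith
  have h2 := h.sqrt
  simp only [sqrt_zero] at h2
  refine h2.congr fun k => ?_
  rw [sqrt_sq (bc_nonneg h0 k)]

lemma hasSum_tele {d : ℝ} (h0 : 0 < d) (h1 : d < 1/2) :
    HasSum (fun k => bc d (k + 1) - bc d k) (-1) := by
  have h : HasSum (fun k => bc d k - bc d (k + 1)) 1 := by
    rw [hasSum_iff_tendsto_nat_of_nonneg]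
    · simp_rw [Finset.sum_range_sub', bc_zero]
      simpa using (bc_tendsto h0 h1).const_sub 1
    · intro k
      have hs := bc_succ d k
      have hb := bc_nonneg h0 k
      have hk : (0:ℝ) ≤ k := by positivity
      have e : bc d (k + 1) = bc d k * ((d + k) / (k + 1)) := by field_simp; linarith
      have : (d + k) / (k + 1) ≤ 1 := by rw [div_le_one (by positivity)]; linarith
      rw [e]; nlinarith
  simpa using h.neg

lemma hasSum_of_ofReal {f : ℕ → ℝ} (hf : ∀ k, 0 ≤ f k) {s : ℝ} (hs : 0 ≤ s)
    (h : ∑' k, ENNReal.ofReal (f k) = ENNReal.ofReal s) : HasSum f s := by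
  have hsum : Summable f := by
    have := ENNReal.summable_toReal (f := fun k => ENNReal.ofReal (f k)) (by rw [h]; simp)
    simpa [ENNReal.toReal_ofReal, hf] using this
  rw [← ENNReal.ofReal_tsum_of_nonneg hf hsum, ENNReal.ofReal_eq_ofReal_iff (tsum_nonneg hf) hs] at h
  rw [← h]
  exact hsum.hasSum

lemma hasSum_bcBeta {d : ℝ} (h0 : 0 < d) (h1 : d < 1/2) :
    HasSum (fun k : ℕ => bc d k / (k + 2 * d)) (beta (2 * d) (1 - d)) := by
  have hbp := beta_pos (α := 2 * d) (β := 1 - d) (by linarith) (by linarith)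
  refine hasSum_of_ofReal (fun k => div_nonneg (bc_nonneg h0 k) (by positivity)) hbp.le ?_
  rw [← lintBeta (by linarith) (by linarith)]
  have e : ∀ x ∈ Ioo (0:ℝ) 1, ENNReal.ofReal (x ^ (2 * d - 1) * (1 - x) ^ (1 - d - 1)) =
      ∑' k : ℕ, ENNReal.ofReal (bc d k) * ENNReal.ofReal (x ^ ((k + 2 * d) - 1)) := by
    intro x hx
    have hx0 := hx.1
    rw [ENNReal.ofReal_mul (by positivity), show 1 - d - 1 = -d by ring,
      ofReal_series h0 hx0.le hx.2, ← ENNReal.tsum_mul_left]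
    refine tsum_congr fun k => ?_
    rw [← ENNReal.ofReal_mul (by positivity), ← ENNReal.ofReal_mul (bc_nonneg h0 k),
      show k + 2 * d - 1 = (2 * d - 1) + k by ring, rpow_add hx0, rpow_natCast]
    congr 1
    ring
  rw [setLIntegral_congr_fun measurableSet_Ioo e, lintegral_tsum (fun k => by fun_prop)]
  refine tsum_congr fun k => ?_
  rw [lintegral_const_mul _ (by fun_prop), lintPow0 (by positivity) one_pos,
    ← ENNReal.ofReal_mul (bc_nonneg h0 k), one_rpow, mul_one_div]

lemma hasSum_V {d : ℝ} (h0 : 0 < d) (h1 : d < 1/2) :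
    HasSum (fun k : ℕ => bc d k / (2 * d - 1 + k)) (d * beta (2 * d) (1 - d) / (2 * d - 1)) := by
  have hd : 2 * d - 1 ≠ 0 := by linarith
  have h := ((hasSum_tele h0 h1).add ((hasSum_bcBeta h0 h1).mul_left d)).div_const (2 * d - 1)
  rw [← hasSum_nat_add_iff' 1]
  convert! h using 1
  · funext k
    have hs := bc_succ d k
    have hk : (0:ℝ) < k + 2 * d := by positivity
    have e : (2 * d - 1 + ((k + 1 : ℕ) : ℝ)) = k + 2 * d := by push_cast; ring
    rw [e]
    field_simp
    linarith
  · simp [bc_zero]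
    field_simp
    ring

lemma ac_le {d : ℝ} (h0 : 0 < d) (h1 : d < 1/2) (k : ℕ) : ac d k ≤ 2 / (k + 1) := by
  have key : poch d k * (k + 1) ≤ poch (2 - d) k := by
    induction k with
    | zero => simp [poch]
    | succ k ih =>
      rw [poch_succ, poch_succ]
      have hp := poch_pos h0 k
      have hk : (0:ℝ) ≤ k := by positivity
      push_cast
      calc poch d k * (d + k) * (k + 1 + 1) ≤ poch d k * ((k + 1) * (2 - d + k)) := by
            rw [mul_assoc]
            apply mul_le_mul_of_nonneg_left _ hp.le
            nlinarith
        _ = poch d k * (k + 1) * (2 - d + k) := by ring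
        _ ≤ _ := by
          gcongr
          linarith
  have hp := poch_pos (a := 2 - d) (by linarith) k
  have hd : 0 < 1 - d := by linarith
  unfold ac
  rw [div_le_div_iff₀ (by positivity) (by positivity)]
  nlinarith

lemma sum_ac0 : Summable fun k : ℕ => 1 / ((k : ℝ) + 1) ^ 2 := by
  have := (summable_nat_add_iff 1).2 (Real.summable_one_div_nat_pow.2 (one_lt_two : 1 < 2))
  simpa using this

lemma sum_ac3 {d : ℝ} (h0 : 0 < d) (h1 : d < 1/2) :
    Summable fun k : ℕ => ac d k / (k + (3 - 3 * d)) := by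
  refine Summable.of_nonneg_of_le (fun k => ?_) (fun k => ?_) (sum_ac0.mul_left 2)
  · have : (0:ℝ) ≤ k := by positivity
    exact div_nonneg (ac_nonneg h0 h1 k) (by linarith)
  · have hk : (0:ℝ) ≤ k := by positivity
    calc ac d k / (k + (3 - 3 * d)) ≤ (2 / (k + 1)) / (k + 1) := by
          apply div_le_div₀ (by positivity) (ac_le h0 h1 k) (by positivity) (by linarith)
      _ = _ := by field_simp

lemma sum_ac2 {d : ℝ} (h0 : 0 < d) (h1 : d < 1/2) :
    Summable fun k : ℕ => ac d k / (2 * d - 1 + k) := by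
  rw [← summable_nat_add_iff 1]
  refine Summable.of_nonneg_of_le (fun k => ?_) (fun k => ?_) (sum_ac0.mul_left (2 / (2 * d)))
  · have : (0:ℝ) ≤ k := by positivity
    exact div_nonneg (ac_nonneg h0 h1 _) (by push_cast; linarith)
  · have hk : (0:ℝ) ≤ k := by positivity
    calc ac d (k + 1) / (2 * d - 1 + (k + 1 : ℕ)) ≤ (2 / (k + 1)) / (2 * d * (k + 1)) := by
          apply div_le_div₀ (by positivity) _ (by positivity) (by push_cast; nlinarith)
          refine (ac_le h0 h1 _).trans ?_
          gcongr
          simp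
      _ = _ := by field_simp

noncomputable def sT (d : ℝ) (k : ℕ) : ℝ := poch d k / (poch (3 - 2 * d) k * (2 * d - 1 + k))

lemma r_ne {d : ℝ} (h0 : 0 < d) (h1 : d < 1/2) (k : ℕ) : 2 * d - 1 + (k:ℝ) ≠ 0 := by
  rcases k with _ | k
  · simp; linarith
  · push_cast
    have : (0:ℝ) ≤ k := by positivity
    linarith

lemma hasSum_s {d : ℝ} (h0 : 0 < d) (h1 : d < 1/2) :
    HasSum (sT d) ((2 - 2 * d) * (beta (2 - 2 * d) (2 - 2 * d) * (d * beta (2 * d) (1 - d) / (2 * d - 1)) -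
      ∑' k : ℕ, ac d k / (k + (3 - 3 * d)))) := by
  have hX := X_eq h0 h1
  rw [lemG (bc_nonneg h0) (by linarith) (by linarith) (r_ne h0 h1) (by linarith),
    ← ENNReal.ofReal_tsum_of_nonneg _ (sum_ac3 h0 h1)] at hX
  swap
  · intro k
    have : (0:ℝ) ≤ k := by positivity
    exact div_nonneg (ac_nonneg h0 h1 k) (by linarith)
  have h := hasSum_of_ofReal (fun k => ?_) (tsum_nonneg fun k => ?_) hX
  rotate_left
  · refine mul_nonneg (bc_nonneg h0 k) (Gterm (by linarith) (by linarith) (r_ne h0 h1 k) ?_).1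
    have : (0:ℝ) ≤ k := by positivity
    linarith
  · have : (0:ℝ) ≤ k := by positivity
    exact div_nonneg (ac_nonneg h0 h1 k) (by linarith)
  have h2 := (((hasSum_V h0 h1).mul_left (beta (2 - 2 * d) (2 - 2 * d))).sub h).mul_left (2 - 2 * d)
  convert! h2 using 1
  funext k
  have hb := bcBeta d (q := 2 - 2 * d) (by linarith) k
  rw [show 2 - 2 * d + (2 * d - 1 + (k:ℝ)) = k + 1 by ring]
  have hr := r_ne h0 h1 k
  have hp := poch_pos (a := 3 - 2 * d) (by linarith) k
  rw [show 2 - 2 * d + 1 = 3 - 2 * d by ring] at hb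
  have hq : 2 - 2 * d ≠ 0 := by linarith
  have hd : 1 - d ≠ 0 := by linarith
  have e : (2 - 2 * d) * (bc d k * beta (k + 1) (2 - 2 * d)) = poch d k / poch (3 - 2 * d) k := by
    rw [hb]; field_simp
  have e2 : sT d k = (poch d k / poch (3 - 2 * d) k) / (2 * d - 1 + k) := by
    rw [sT, div_div]
  rw [e2, ← e]
  field_simp
  ring

lemma JE_val {d : ℝ} (h0 : 0 < d) (h1 : d < 1/2) :
    ∃ v : ℝ, 0 ≤ v ∧ JE d = ENNReal.ofReal v ∧
      v = beta (3 - 3 * d) (1 - d) * (∑' k : ℕ, ac d k / (2 * d - 1 + k)) -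
        Gamma (1 - d) ^ 2 / Gamma (3 - 2 * d) * ∑' k, sT d k := by
  have hJ := JE_eq h0 h1
  unfold Fs at hJ
  rw [lemG (ac_nonneg h0 h1) (by linarith) (by linarith) (r_ne h0 h1) (by linarith)] at hJ
  have hn : ∀ k : ℕ, 0 ≤ ac d k * ((beta (3 - 3 * d) (1 - d) -
      beta (3 - 3 * d + (2 * d - 1 + k)) (1 - d)) / (2 * d - 1 + k)) := by
    intro k
    refine mul_nonneg (ac_nonneg h0 h1 k) (Gterm (by linarith) (by linarith) (r_ne h0 h1 k) ?_).1
    have : (0:ℝ) ≤ k := by positivity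
    linarith
  have hs : HasSum (fun k : ℕ => ac d k * ((beta (3 - 3 * d) (1 - d) -
      beta (3 - 3 * d + (2 * d - 1 + k)) (1 - d)) / (2 * d - 1 + k)))
      (beta (3 - 3 * d) (1 - d) * (∑' k : ℕ, ac d k / (2 * d - 1 + k)) -
        Gamma (1 - d) ^ 2 / Gamma (3 - 2 * d) * ∑' k, sT d k) := by
    have h2 := ((sum_ac2 h0 h1).hasSum.mul_left (beta (3 - 3 * d) (1 - d))).sub
      ((hasSum_s h0 h1).summable.hasSum.mul_left (Gamma (1 - d) ^ 2 / Gamma (3 - 2 * d)))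
    convert! h2 using 1
    funext k
    have hr := r_ne h0 h1 k
    have hp := poch_pos (a := 3 - 2 * d) (by linarith) k
    have hp2 := poch_pos (a := 2 - d) (by linarith) k
    have g1 := Gamma_pos_of_pos (s := 1 - d) (by linarith)
    have g2 := Gamma_pos_of_pos (s := 3 - 2 * d) (by linarith)
    have hd : 1 - d ≠ 0 := by linarith
    have e : ac d k * beta (3 - 3 * d + (2 * d - 1 + k)) (1 - d) =
        Gamma (1 - d) ^ 2 / Gamma (3 - 2 * d) * (poch d k / poch (3 - 2 * d) k) := by
      unfold ac beta
      rw [show 3 - 3 * d + (2 * d - 1 + (k:ℝ)) + (1 - d) = (3 - 2 * d) + k by ring,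
        show 3 - 3 * d + (2 * d - 1 + (k:ℝ)) = (2 - d) + k by ring,
        Gamma_poch (by linarith), Gamma_poch (by linarith), show 2 - d = (1 - d) + 1 by ring,
        Gamma_add_one hd]
      rw [show 2 - d = (1 - d) + 1 by ring] at hp2
      field_simp
    have e2 : sT d k = (poch d k / poch (3 - 2 * d) k) / (2 * d - 1 + k) := by
      rw [sT, div_div]
    rw [e2, ← mul_div_assoc, ← mul_div_assoc, ← mul_div_assoc, ← e]
    ring
  refine ⟨_, hs.nonneg hn, ?_, rfl⟩
  rw [hJ, ← hs.tsum_eq, ENNReal.ofReal_tsum_of_nonneg hn hs.summable]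

lemma F32_a {d : ℝ} (h0 : 0 < d) (h1 : d < 1/2) :
    F32 1 d (2*d-1) (2-d) (2*d) = (1 - d) * (2 * d - 1) * ∑' k : ℕ, ac d k / (2 * d - 1 + k) := by
  unfold F32
  rw [← tsum_mul_left]
  refine tsum_congr fun k => ?_
  have hr := r_ne h0 h1 k
  have hs := poch_shift (2 * d - 1) k
  rw [show 2 * d - 1 + 1 = 2 * d by ring] at hs
  have hp := poch_pos (a := 2 * d) (by linarith) k
  have hp2 := poch_pos (a := 2 - d) (by linarith) k
  have hd : 1 - d ≠ 0 := by linarith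
  have : (0:ℝ) < k.factorial := by positivity
  rw [poch_one, ac]
  field_simp
  linear_combination (poch d k) * hs

lemma F32_b {d : ℝ} (h0 : 0 < d) (h1 : d < 1/2) :
    F32 1 d (3-3*d) (2-d) (4-3*d) = (1 - d) * (3 - 3 * d) * ∑' k : ℕ, ac d k / (k + (3 - 3 * d)) := by
  unfold F32
  rw [← tsum_mul_left]
  refine tsum_congr fun k => ?_
  have hk : (0:ℝ) ≤ k := by positivity
  have hr : (k:ℝ) + (3 - 3 * d) ≠ 0 := by linarith
  have hs := poch_shift (3 - 3 * d) k
  rw [show 3 - 3 * d + 1 = 4 - 3 * d by ring] at hs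
  have hp := poch_pos (a := 4 - 3 * d) (by linarith) k
  have hp2 := poch_pos (a := 2 - d) (by linarith) k
  have hd : 1 - d ≠ 0 := by linarith
  have : (0:ℝ) < k.factorial := by positivity
  rw [poch_one, ac, div_div, ← mul_div_assoc, div_eq_div_iff (by positivity) (by positivity)]
  linear_combination (k.factorial : ℝ) * poch d k * poch (2 - d) k * (1 - d) * hs


theorem stmt11 (d : ℝ) (h0 : 0 < d) (h1 : d < 1/2) :
    (∫ y1 in (0:ℝ)..1, ∫ y2 in (0:ℝ)..y1, ∫ y3 in (0:ℝ)..y2, ∫ y4 in (0:ℝ)..y3, ∫ y5 in (0:ℝ)..y4,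
      (y1 - y3) ^ (-d) * (y3 - y4) ^ (-d) * (y2 - y4) ^ (-d) * (y2 - y5) ^ (-d) * (y1 - y5) ^ (-d)) =
    Gamma (1-d) / (1-d) * (Gamma (2*d-1) / Gamma (2*d)) *
      (Gamma (3-3*d) * Gamma (4-5*d) / (Gamma (6-5*d) * Gamma (4-4*d))) *
      F32 1 d (2*d-1) (2-d) (2*d) -
      Gamma (1-d) ^ 3 * (Gamma (4-5*d) / (Gamma (4-4*d) * Gamma (6-5*d))) *
      (Gamma (2-2*d) * Gamma (2*d-1) / Gamma d) +
      Gamma (1-d) ^ 2 / (3 * (1-d) ^ 2) * (Gamma (4-5*d) / (Gamma (6-5*d) * Gamma (2-2*d))) *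
      F32 1 d (3-3*d) (2-d) (4-3*d) := by
  obtain ⟨v, hv0, hJ, hv⟩ := JE_val h0 h1
  have hE := E5_eq h0 h1
  have p4 : 0 < 4 - 5 * d := by linarith
  have p5 : 0 < 5 - 5 * d := by linarith
  rw [hJ, ← ENNReal.ofReal_mul (by positivity)] at hE
  rw [int_eq d (by rw [hE]; simp), hE, ENNReal.toReal_ofReal (by positivity), hv,
    (hasSum_s h0 h1).tsum_eq, F32_a h0 h1, F32_b h0 h1]
  generalize (∑' k : ℕ, ac d k / (2 * d - 1 + k)) = A
  generalize (∑' k : ℕ, ac d k / (k + (3 - 3 * d))) = T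
  unfold beta
  have pd : 1 - d ≠ 0 := by linarith
  have pd2 : 2 * d - 1 ≠ 0 := by linarith
  have e6 : Gamma (6 - 5 * d) = (5 - 5 * d) * ((4 - 5 * d) * Gamma (4 - 5 * d)) := by
    rw [← Gamma_add_one p4.ne', show 4 - 5 * d + 1 = 5 - 5 * d by ring, ← Gamma_add_one p5.ne']
    congr 1; ring
  have e2 : Gamma (2 * d) = (2 * d - 1) * Gamma (2 * d - 1) := by
    rw [← Gamma_add_one pd2]; congr 1; ring
  have e3 : Gamma (3 - 2 * d) = (2 - 2 * d) * Gamma (2 - 2 * d) := by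
    rw [← Gamma_add_one (by linarith)]; congr 1; ring
  have e1 : Gamma (2 * d + (1 - d)) = d * Gamma d := by
    rw [← Gamma_add_one h0.ne']; congr 1; ring
  have g2 : Gamma (2 * d - 1) ≠ 0 := by
    intro h
    have := Gamma_pos_of_pos (s := 2 * d) (by linarith)
    rw [e2, h, mul_zero] at this
    exact lt_irrefl _ this
  have g4 := (Gamma_pos_of_pos p4).ne'
  have g0 := (Gamma_pos_of_pos h0).ne'
  have g22 := (Gamma_pos_of_pos (s := 2 - 2 * d) (by linarith)).ne'
  have g44 := (Gamma_pos_of_pos (s := 4 - 4 * d) (by linarith)).ne'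
  rw [e1, e6, e3, e2, show 3 - 3 * d + (1 - d) = 4 - 4 * d by ring,
    show 2 - 2 * d + (2 - 2 * d) = 4 - 4 * d by ring]
  have q22 : 2 - 2 * d = 2 * (1 - d) := by ring
  have q33 : 3 - 3 * d = 3 * (1 - d) := by ring
  have q55 : 5 - 5 * d = 5 * (1 - d) := by ring
  generalize Gamma (3 - 3 * d) = G33
  generalize Gamma (2 - 2 * d) = G22 at *
  generalize Gamma (4 - 4 * d) = G44 at *
  generalize Gamma (4 - 5 * d) = G45 at *
  generalize Gamma (1 - d) = G1 at *
  generalize Gamma (2 * d - 1) = G2 at *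
  generalize Gamma d = G0 at *
  have p4' := p4.ne'
  rw [q22, q33, q55]
  have hd0 := h0.ne'
  clear hE hv hJ e1 e2 e3 e6 q22 q33 q55 p4 p5
  generalize 2 * d - 1 = r at *
  generalize 1 - d = s at *
  generalize 4 - 5 * d = u at *
  field_simp
  ring
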